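/- Let L/F be a finite Galois extension of fields and d ≥ 1. Let M be an invertible d × d matrix over L such that for every σ in the Galois group Gal(L/F), the matrix σ(M) obtained by applying σ to each entry of M is conjugate to M by an invertible matrix over L. Then there exists an invertible d × d matrix N with entries in F such that M is conjugate to N by an invertible matrix over L. -/

import Mathlib

open Polynomial Module

theorem rank_map_aux {L : Type*} [Field L] {ι : Type*} [Fintype ι] [DecidableEq ι]
    (A : Matrix ι ι L) (s : L ≃+* L) : (A.map s).rank = A.rank := by
  unfold Matrix.rank
  let E : (ι → L) ≃+ (ι → L) := AddEquiv.piCongrRight (fun _ => s.toAddEquiv)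
  have hE : ∀ v i, E v i = s (v i) := fun v i => rfl
  have hmul : ∀ v, E (A.mulVec v) = (A.map s).mulVec (E v) := by
    intro v
    ext i
    simp [hE, Matrix.mulVec, dotProduct, map_sum]
  let j : (LinearMap.range A.mulVecLin) ≃+ (LinearMap.range (A.map s).mulVecLin) :=
    { toFun := fun x => ⟨E x.1, by
        obtain ⟨x, v, rfl⟩ := x
        exact ⟨E v, (hmul v).symm⟩⟩
      invFun := fun x => ⟨E.symm x.1, by
        obtain ⟨x, v, rfl⟩ := x
        refine ⟨E.symm v, ?_⟩
        apply E.injective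
        simp [hmul]⟩
      left_inv := fun x => by simp
      right_inv := fun x => by simp
      map_add' := fun x y => by ext; simp }
  unfold Module.finrank
  congr 1
  refine (rank_eq_of_equiv_equiv (s : L → L) j s.bijective ?_).symm
  intro r m
  ext i
  simp [j, hE]

section
variable {L : Type*} [Field L] 

theorem toMatrix_lsmul_aux {V : Type*} [AddCommGroup V] [Module L V] [Module L[X] V]
    [IsScalarTower L L[X] V] {ι : Type*} [Fintype ι] [DecidableEq ι] (b : Basis ι L V) (g : L[X]) :
    LinearMap.toMatrixAlgEquiv b (Algebra.lsmul L L V g) =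
      aeval (LinearMap.toMatrixAlgEquiv b (Algebra.lsmul L L V (X : L[X]))) g := by
  have : ((LinearMap.toMatrixAlgEquiv b).toAlgHom.comp (Algebra.lsmul L L V : L[X] →ₐ[L] _)) =
      aeval (LinearMap.toMatrixAlgEquiv b (Algebra.lsmul L L V (X : L[X]))) := by
    ext1; simp
  exact congrArg (fun f => f g) this

/-- rank of the action of `g`. -/
noncomputable def rkAct (V : Type*) [AddCommGroup V] [Module L V] [Module L[X] V]
    [IsScalarTower L L[X] V] (g : L[X]) : ℕ :=
  finrank L (LinearMap.range (Algebra.lsmul L L V g))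

theorem rkAct_eq_rank {V : Type*} [AddCommGroup V] [Module L V] [Module L[X] V]
    [IsScalarTower L L[X] V] {ι : Type*} [Fintype ι] [DecidableEq ι] (b : Basis ι L V) (g : L[X]) :
    rkAct V g =
      (aeval (LinearMap.toMatrixAlgEquiv b (Algebra.lsmul L L V (X : L[X]))) g).rank := by
  rw [← toMatrix_lsmul_aux, Matrix.rank_eq_finrank_range_toLin _ b b]
  rw [show (Matrix.toLin b b) ((LinearMap.toMatrixAlgEquiv b) (Algebra.lsmul L L V g))
    = Algebra.lsmul L L V g from Matrix.toLin_toMatrix b b _]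
  rfl

theorem rank_aeval_conj {ι : Type*} [Fintype ι] [DecidableEq ι] (A P : Matrix ι ι L) (hP : IsUnit P)
    (s : L ≃+* L) (h : P * A * P⁻¹ = A.map s) (g : L[X]) :
    (aeval A g).rank = (aeval A (g.map (s : L →+* L))).rank := by
  have h1 : (aeval A g).map s = aeval (A.map s) (g.map (s : L →+* L)) := by
    have := Polynomial.map_aeval_eq_aeval_map (R := L) (S := Matrix ι ι L) (T := L)
      (U := Matrix ι ι L) (φ := (s : L →+* L)) (ψ := (s : L →+* L).mapMatrix) (by
        ext x i j
        simp [Matrix.algebraMap_matrix_apply]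
        split_ifs <;> simp) g A
    exact this
  have hdet : IsUnit P.det := (Matrix.isUnit_iff_isUnit_det P).1 hP
  have h2 : ∀ q : L[X], aeval (P * A * P⁻¹) q = P * aeval A q * P⁻¹ := by
    obtain ⟨u, rfl⟩ := hP
    intro q
    rw [← Matrix.coe_units_inv]
    induction q using Polynomial.induction_on' with
    | add p q hp hq => rw [map_add, map_add, hp, hq, mul_add, add_mul]
    | monomial n a =>
      rw [aeval_monomial, aeval_monomial, Units.conj_pow, ← mul_assoc, ← mul_assoc, ← mul_assoc, Algebra.commutes]
  rw [← rank_map_aux _ s, h1, ← h, h2, Matrix.rank_mul_eq_left_of_isUnit_det,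
    Matrix.rank_mul_eq_right_of_isUnit_det _ _ hdet]
  exact (Matrix.isUnit_nonsing_inv_det_iff).2 hdet

theorem rkAct_congr {V W : Type*} [AddCommGroup V] [Module L V] [Module L[X] V]
    [IsScalarTower L L[X] V] [AddCommGroup W] [Module L W] [Module L[X] W]
    [IsScalarTower L L[X] W] (e : V ≃ₗ[L[X]] W) (g : L[X]) : rkAct V g = rkAct W g := by
  unfold rkAct
  have : LinearMap.range (Algebra.lsmul L L W g) =
    (LinearMap.range (Algebra.lsmul L L V g)).map (e.restrictScalars L).toLinearMap := by
    ext w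
    constructor
    · rintro ⟨v, rfl⟩
      exact ⟨_, ⟨e.symm v, rfl⟩, by simp⟩
    · rintro ⟨_, ⟨v, rfl⟩, rfl⟩
      exact ⟨e v, by simp⟩
  rw [this]
  exact (LinearEquiv.finrank_map_eq (e.restrictScalars L) _).symm

theorem rkAct_prod {V W : Type*} [AddCommGroup V] [Module L V] [Module L[X] V]
    [IsScalarTower L L[X] V] [AddCommGroup W] [Module L W] [Module L[X] W]
    [IsScalarTower L L[X] W] [Module.Finite L V] [Module.Finite L W] (g : L[X]) :
    rkAct (V × W) g = rkAct V g + rkAct W g := by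
  unfold rkAct
  have : Algebra.lsmul L L (V × W) g =
    LinearMap.prodMap (Algebra.lsmul L L V g) (Algebra.lsmul L L W g) := by
    ext <;> simp
  rw [this, LinearMap.range_prodMap, ← Module.finrank_prod]
  let p := LinearMap.range (Algebra.lsmul L L V g)
  let q := LinearMap.range (Algebra.lsmul L L W g)
  have e : (p.prod q) ≃ₗ[L] p × q :=
    { toFun := fun x => (⟨x.1.1, x.2.1⟩, ⟨x.1.2, x.2.2⟩)
      invFun := fun x => ⟨(x.1.1, x.2.1), x.1.2, x.2.2⟩
      left_inv := fun _ => rfl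
      right_inv := fun _ => rfl
      map_add' := fun _ _ => rfl
      map_smul' := fun _ _ => rfl }
  exact e.finrank_eq

/-- Rational basis. -/
def HasRat (F L : Type*) [Field F] [Field L] [Algebra F L]
    (V : Type*) [AddCommGroup V] [Module L V] [Module L[X] V] : Prop :=
  ∃ (ι : Type) (_ : Fintype ι) (b : Basis ι L V),
    ∀ i j, b.repr ((X : L[X]) • b j) i ∈ Set.range (algebraMap F L)

theorem HasRat.congr {F : Type*} [Field F] [Algebra F L] {V W : Type*}
    [AddCommGroup V] [Module L V] [Module L[X] V]
    [IsScalarTower L L[X] V] [AddCommGroup W] [Module L W] [Module L[X] W]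
    [IsScalarTower L L[X] W] (e : V ≃ₗ[L[X]] W) (h : HasRat F L V) : HasRat F L W := by
  obtain ⟨ι, _, b, hb⟩ := h
  refine ⟨ι, inferInstance, b.map (e.restrictScalars L), fun i j => ?_⟩
  have := hb i j
  simpa using this

theorem HasRat.prod {F : Type*} [Field F] [Algebra F L] {V W : Type*}
    [AddCommGroup V] [Module L V] [Module L[X] V]
    [AddCommGroup W] [Module L W] [Module L[X] W]
     (h : HasRat F L V) (h' : HasRat F L W) : HasRat F L (V × W) := by
  obtain ⟨ι, _, b, hb⟩ := h
  obtain ⟨κ, _, c, hc⟩ := h'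
  refine ⟨ι ⊕ κ, inferInstance, b.prod c, ?_⟩
  rintro (i | i) (j | j)
  · simpa using hb i j
  · simp
  · simp
  · simpa using hc i j

theorem HasRat.rkAct {F : Type*} [Field F] [Algebra F L] {V : Type*}
    [AddCommGroup V] [Module L V] [Module L[X] V]
    [IsScalarTower L L[X] V] (h : HasRat F L V) (s : L ≃ₐ[F] L) (g : L[X]) :
    rkAct V g = rkAct V (g.map (s : L →+* L)) := by
  classical
  obtain ⟨ι, _, b, hb⟩ := h
  rw [rkAct_eq_rank b, rkAct_eq_rank b]
  refine rank_aeval_conj _ 1 isUnit_one s.toRingEquiv ?_ g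
  ext i j
  obtain ⟨c, hc⟩ := hb i j
  simp [LinearMap.toMatrixAlgEquiv_apply, ← hc]

theorem hasRat_quot {F : Type*} [Field F] [Algebra F L] (f0 : F[X]) (hf0 : f0.Monic) :
    HasRat F L (L[X] ⧸ Ideal.span {f0.map (algebraMap F L)}) := by
  have hf := hf0.map (algebraMap F L)
  let B : Basis (Fin (f0.map (algebraMap F L)).natDegree) L
    (L[X] ⧸ Ideal.span {f0.map (algebraMap F L)}) := AdjoinRoot.powerBasisAux' hf
  refine ⟨Fin _, inferInstance, B, fun i j => ?_⟩
  have h1 : (X : L[X]) • (B j) =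
      Ideal.Quotient.mk (Ideal.span {f0.map (algebraMap F L)}) (X ^ (j.1 + 1)) := by
    have h2 : B j = Ideal.Quotient.mk (Ideal.span {f0.map (algebraMap F L)}) (X ^ j.1) := by
      have := (AdjoinRoot.powerBasis' hf).basis_eq_pow j
      refine this.trans ?_
      rw [AdjoinRoot.powerBasis'_gen, map_pow]
      rfl
    rw [h2, pow_succ', map_mul]
    rfl
  refine ⟨(X ^ (j.1 + 1) %ₘ f0).coeff i, ?_⟩
  rw [← coeff_map, map_modByMonic _ hf0, Polynomial.map_pow, map_X, h1]
  rfl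
end

theorem split_aux {L : Type*} [Field L] {V : Type*}
    [AddCommGroup V] [Module L V] [Module L[X] V]
    [IsScalarTower L L[X] V] (f : L[X]) (hf : f.Monic)
    (i : (L[X] ⧸ Ideal.span {f}) →ₗ[L[X]] V) (hi : Function.Injective i)
    (hV : ∀ v : V, f • v = 0) :
    ∃ K : Submodule L[X] V, Nonempty (((L[X] ⧸ Ideal.span {f}) × K) ≃ₗ[L[X]] V) := by
  have hn1 : f ≠ 0 := hf.ne_zero
  let iL : (L[X] ⧸ Ideal.span {f}) →ₗ[L] V := i.restrictScalars L
  obtain ⟨l, hl⟩ := LinearMap.exists_leftInverse_of_injective iL (LinearMap.ker_eq_bot.2 hi)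
  let φ0 : (L[X] ⧸ Ideal.span {f}) →ₗ[L] L :=
    (lcoeff L (f.natDegree - 1)).comp (AdjoinRoot.modByMonicHom hf)
  have hφ0 : ∀ p : L[X], φ0 (Ideal.Quotient.mk _ p) = (p %ₘ f).coeff (f.natDegree - 1) :=
    fun p => rfl
  let φ : V →ₗ[L] L := φ0.comp l
  have hφ : ∀ u, φ (i u) = φ0 u := fun u => congrArg φ0 (LinearMap.congr_fun hl u)
  have key : ∀ u : L[X] ⧸ Ideal.span {f},
      (∀ j : Fin f.natDegree, φ ((X ^ j.1 : L[X]) • i u) = 0) → u = 0 := by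
    intro u hu
    obtain ⟨p0, rfl⟩ := Ideal.Quotient.mk_surjective u
    have hp : Ideal.Quotient.mk (Ideal.span {f}) p0 =
        Ideal.Quotient.mk (Ideal.span {f}) (p0 %ₘ f) := by
      rw [Ideal.Quotient.mk_eq_mk_iff_sub_mem, Ideal.mem_span_singleton]
      exact ⟨p0 /ₘ f, by rw [modByMonic_eq_sub_mul_div]; ring⟩
    rw [hp] at hu ⊢
    set p := p0 %ₘ f with hpdef
    by_contra hne
    have hp0 : p ≠ 0 := by
      intro h0
      exact hne (by rw [h0, map_zero])
    have hdeg : p.degree < f.degree := degree_modByMonic_lt _ hf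
    have hnd : p.natDegree < f.natDegree := natDegree_lt_natDegree hp0 hdeg
    have := hu ⟨f.natDegree - 1 - p.natDegree, by omega⟩
    rw [← map_smul, hφ] at this
    have h2 : (X ^ (f.natDegree - 1 - p.natDegree) : L[X]) • Ideal.Quotient.mk (Ideal.span {f}) p
      = Ideal.Quotient.mk (Ideal.span {f}) (X ^ (f.natDegree - 1 - p.natDegree) * p) := rfl
    rw [h2, hφ0, (modByMonic_eq_self_iff hf).2] at this
    · rw [coeff_X_pow_mul', if_pos (by omega)] at this
      rw [show f.natDegree - 1 - (f.natDegree - 1 - p.natDegree) = p.natDegree by omega] at this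
      exact hp0 (leadingCoeff_eq_zero.1 this)
    · apply degree_lt_degree
      rw [natDegree_X_pow_mul _ hp0]
      omega
  let D : V →ₗ[L] (Fin f.natDegree → L) :=
    LinearMap.pi fun j => φ.comp (Algebra.lsmul L L V (X ^ j.1 : L[X]))
  have hD : ∀ v j, D v j = φ ((X ^ j.1 : L[X]) • v) := fun v j => rfl
  let B : Basis (Fin f.natDegree) L (L[X] ⧸ Ideal.span {f}) := AdjoinRoot.powerBasisAux' hf
  have : Module.Finite L (L[X] ⧸ Ideal.span {f}) := Module.Finite.of_basis B
  have hDi : Function.Injective (D.comp iL) := by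
    rw [injective_iff_map_eq_zero]
    intro u hu
    exact key u fun j => congrFun hu j
  have hDs : Function.Surjective (D.comp iL) := by
    refine (LinearMap.injective_iff_surjective_of_finrank_eq_finrank ?_).1 hDi
    rw [Module.finrank_eq_card_basis B]
    simp
  let K : Submodule L[X] V :=
    { carrier := {v | ∀ g : L[X], φ (g • v) = 0}
      add_mem' := fun {a b} ha hb g => by rw [smul_add, map_add, ha g, hb g, add_zero]
      zero_mem' := fun g => by rw [smul_zero, map_zero]
      smul_mem' := fun c v hv g => by rw [smul_smul]; exact hv _ }
  have hK : ∀ v, D v = 0 → v ∈ K := by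
    intro v hv g
    have h1 : g • v = (g %ₘ f) • v := by
      conv_lhs => rw [← modByMonic_add_div g f, add_smul, mul_comm, mul_smul, hV, smul_zero, add_zero]
    rw [h1, ← sum_modByMonic_coeff (q := f) hf (p := g) degree_le_natDegree, Finset.sum_smul, map_sum]
    refine Finset.sum_eq_zero fun j _ => ?_
    have h2 := congrFun hv j
    rw [hD] at h2
    rw [← C_mul_X_pow_eq_monomial, ← smul_eq_C_mul, smul_assoc, map_smul, h2]
    simp
  refine ⟨K, ⟨LinearEquiv.ofBijective (i.coprod K.subtype) ⟨?_, ?_⟩⟩⟩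
  · rw [injective_iff_map_eq_zero]
    rintro ⟨u, k⟩ h
    have h' : i u + k.1 = 0 := h
    have hu : u = 0 := by
      apply key
      intro j
      have : i u ∈ K := by
        rw [eq_neg_of_add_eq_zero_left h']
        exact K.neg_mem k.2
      exact this _
    subst hu
    rw [map_zero, zero_add] at h'
    ext
    · rfl
    · exact h'
  · intro v
    obtain ⟨u, hu⟩ := hDs (D v)
    refine ⟨(u, ⟨v - i u, hK _ ?_⟩), ?_⟩
    · rw [map_sub, ← hu]; exact sub_self _
    · simp

theorem hasRat_of_rkAct {F L : Type*} [Field F] [Field L] [Algebra F L]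
    [FiniteDimensional F L] [IsGalois F L] (n : ℕ) : ∀ (V : Type*)
    [AddCommGroup V] [Module L V] [Module L[X] V]
    [IsScalarTower L L[X] V] [Module.Finite L V] (_ : finrank L V ≤ n)
    (_ : ∀ (s : L ≃ₐ[F] L) (g : L[X]), rkAct V g = rkAct V (g.map (s : L →+* L))),
    HasRat F L V := by
  have triv : ∀ (V : Type _) [AddCommGroup V] [Module L V] [Module L[X] V] [Module.Finite L V],
      finrank L V = 0 → HasRat F L V := by
    intro V _ _ _ _ h0
    have : Subsingleton V := Module.finrank_zero_iff.1 h0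
    exact ⟨Fin 0, inferInstance, Basis.empty V, fun i => i.elim0⟩
  induction n with
  | zero =>
    intro V _ _ _ _ _ hn _
    exact triv V (by omega)
  | succ n ih =>
    intro V _ _ _ _ _ hn hs
    by_cases h0 : finrank L V = 0
    · exact triv V h0
    let T : Module.End L V := Algebra.lsmul L L V (X : L[X])
    have hT : ∀ g : L[X], aeval T g = Algebra.lsmul L L V g := by
      intro g
      have : aeval T = (Algebra.lsmul L L V : L[X] →ₐ[L] _) := by ext1; simp [T]
      rw [this]
    let f := minpoly L T
    have hf : f.Monic := minpoly.monic (Algebra.IsIntegral.isIntegral T)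
    have hann : Module.annihilator L[X] V = Ideal.span {f} := by
      ext g
      rw [Ideal.mem_span_singleton, minpoly.dvd_iff, hT, Module.mem_annihilator]
      exact ⟨fun h => LinearMap.ext h, fun h => LinearMap.congr_fun h⟩
    have hV : ∀ v : V, f • v = 0 := by
      apply Module.mem_annihilator.1
      rw [hann]; exact Ideal.mem_span_singleton_self f
    have hfix : ∀ s : L ≃ₐ[F] L, f.map (s : L →+* L) = f := by
      intro s
      have h1 : rkAct V f = 0 := by
        have : Algebra.lsmul L L V f = 0 := LinearMap.ext hV
        unfold rkAct
        rw [this, LinearMap.range_zero, finrank_bot]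
      rw [hs s] at h1
      unfold rkAct at h1
      rw [Submodule.finrank_eq_zero, LinearMap.range_eq_bot, ← hT, ← minpoly.dvd_iff] at h1
      exact eq_of_monic_of_dvd_of_natDegree_le hf (hf.map _) h1 (by rw [natDegree_map])
    obtain ⟨f0, hf0, -, hf0m⟩ : ∃ q : F[X], q.map (algebraMap F L) = f ∧ q.degree = f.degree ∧ q.Monic := by
      refine lifts_and_degree_eq_and_monic ?_ hf
      rw [lifts_iff_coeff_lifts]
      intro k
      rw [IsGalois.mem_range_algebraMap_iff_fixed]
      intro s
      conv_rhs => rw [← hfix s]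
      rw [coeff_map]; rfl
    have : Module.Finite L[X] V := Module.Finite.of_restrictScalars_finite L L[X] V
    obtain ⟨x, hx⟩ := Module.exists_ker_toSpanSingleton_eq_annihilator L[X] V
    rw [hann] at hx
    obtain ⟨K, ⟨e⟩⟩ := split_aux f hf (Submodule.liftQ _ (LinearMap.toSpanSingleton L[X] V x) hx.ge)
      (LinearMap.ker_eq_bot.1 (Submodule.ker_liftQ_eq_bot _ _ _ hx.le)) hV
    have hQ : HasRat F L (L[X] ⧸ Ideal.span {f}) := by
      have := hasRat_quot (L := L) f0 hf0m
      rwa [hf0] at this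
    have hB : Basis (Fin f.natDegree) L (L[X] ⧸ Ideal.span {f}) := AdjoinRoot.powerBasisAux' hf
    have : Module.Finite L (L[X] ⧸ Ideal.span {f}) := Module.Finite.of_basis hB
    have : Module.Finite L K :=
      Module.Finite.of_injective (K.subtype.restrictScalars L) K.injective_subtype
    have hfr : finrank L V = f.natDegree + finrank L K := by
      rw [← (e.restrictScalars L).finrank_eq, Module.finrank_prod, Module.finrank_eq_card_basis hB,
        Fintype.card_fin]
    have hpos : 0 < f.natDegree := by
      have : Nontrivial V := Module.nontrivial_of_finrank_pos (R := L) (by omega)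
      exact minpoly.natDegree_pos (Algebra.IsIntegral.isIntegral T)
    refine HasRat.congr e (hQ.prod (ih K (by omega) ?_))
    intro s g
    have := hs s g
    rw [← rkAct_congr e, ← rkAct_congr e, rkAct_prod, rkAct_prod, hQ.rkAct s g] at this
    omega

/-- A Galois-stable conjugacy class of `GL_d` over a finite Galois extension `L/F` contains a
point rational over `F`: if an invertible matrix `M` over `L` is conjugate (over `L`) to each
of its Galois twists `σ(M)`, then `M` is conjugate over `L` to an invertible matrix with
entries in `F`. -/
theorem galois_stable_conjugacy_class_has_rational_point
    (F L : Type*) [Field F] [Field L] [Algebra F L]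
    [FiniteDimensional F L] [IsGalois F L] (d : ℕ) (hd : 1 ≤ d)
    (M : Matrix (Fin d) (Fin d) L) (hM : IsUnit M)
    (h : ∀ σ : L ≃ₐ[F] L, ∃ P : Matrix (Fin d) (Fin d) L, IsUnit P ∧
      P * M * P⁻¹ = M.map ⇑σ) :
    ∃ N : Matrix (Fin d) (Fin d) F, IsUnit N ∧
      ∃ P : Matrix (Fin d) (Fin d) L, IsUnit P ∧
        P * M * P⁻¹ = N.map (algebraMap F L) := by
  let T : Module.End L (Fin d → L) := Matrix.toLin' M
  let c : Basis (Fin d) L (AEval' T) := (Pi.basisFun L (Fin d)).map (AEval'.of T)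
  have : Module.Finite L (AEval' T) := Module.Finite.of_basis c
  have hc : LinearMap.toMatrixAlgEquiv c (Algebra.lsmul L L (AEval' T) (X : L[X])) = M := by
    ext i j
    rw [LinearMap.toMatrixAlgEquiv_apply]
    simp [c, AEval'.X_smul_of, T]
  have hrat : HasRat F L (AEval' T) := by
    refine hasRat_of_rkAct (F := F) _ (AEval' T) le_rfl fun s g => ?_
    rw [rkAct_eq_rank c, rkAct_eq_rank c, hc]
    obtain ⟨P, hP, hPM⟩ := h s
    exact rank_aeval_conj M P hP s.toRingEquiv hPM g
  obtain ⟨ι, _, b0, hb0⟩ := hrat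
  have hcard : Fintype.card ι = d := by
    rw [← Module.finrank_eq_card_basis b0, Module.finrank_eq_card_basis c, Fintype.card_fin]
  let b : Basis (Fin d) L (AEval' T) := b0.reindex (Fintype.equivFinOfCardEq hcard)
  have hb : ∀ i j, ∃ y, algebraMap F L y = b.repr ((X : L[X]) • b j) i := by
    intro i j
    simpa [b] using hb0 _ _
  choose y hy using hb
  have hPQ : b.toMatrix c * c.toMatrix b = 1 := Basis.toMatrix_mul_toMatrix_flip b c
  have hP : IsUnit (b.toMatrix c) := IsUnit.of_mul_eq_one _ hPQ
  have hinv : (b.toMatrix c)⁻¹ = c.toMatrix b := Matrix.inv_eq_right_inv hPQ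
  have hmain : b.toMatrix c * M * (b.toMatrix c)⁻¹ = (Matrix.of y).map (algebraMap F L) := by
    rw [hinv, ← hc]
    refine (basis_toMatrix_mul_linearMap_toMatrix_mul_basis_toMatrix b c b c
      (Algebra.lsmul L L (AEval' T) (X : L[X]))).trans ?_
    ext i j
    rw [Matrix.map_apply, Matrix.of_apply, hy]
    exact LinearMap.toMatrix_apply b b (Algebra.lsmul L L (AEval' T) (X : L[X])) i j
  refine ⟨Matrix.of y, ?_, b.toMatrix c, hP, hmain⟩
  have hu : IsUnit ((Matrix.of y).map (algebraMap F L)) := by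
    rw [← hmain]
    exact (hP.mul hM).mul (by rw [hinv]; exact IsUnit.of_mul_eq_one_right _ hPQ)
  rw [Matrix.isUnit_iff_isUnit_det] at hu ⊢
  have hdet : ((Matrix.of y).map (algebraMap F L)).det = algebraMap F L (Matrix.of y).det :=
    (RingHom.map_det (algebraMap F L) _).symm
  rw [hdet] at hu
  exact (isUnit_map_iff (algebraMap F L) _).1 hu
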